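/- Let n ≥ 1 and let A, B be nonempty finite subsets of Fin n. For a uniformly random permutation π of Fin n, the probability that min{π(a) : a ∈ A} = min{π(b) : b ∈ B} equals the Jaccard similarity J(A,B) = |A ∩ B| / |A ∪ B|. Equivalently, the number of permutations π of Fin n with min(π(A)) = min(π(B)) equals (|A ∩ B| / |A ∪ B|) · n!. -/

import Mathlib

open Finset

theorem aux_card_eq {n : ℕ} (U : Finset (Fin n)) {x z : Fin n} (hx : x ∈ U) (hz : z ∈ U) :
    (Finset.univ.filter (fun π : Equiv.Perm (Fin n) => ∀ y ∈ U, π x ≤ π y)).card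
      = (Finset.univ.filter (fun π : Equiv.Perm (Fin n) => ∀ y ∈ U, π z ≤ π y)).card := by
  have hs : ∀ y ∈ U, Equiv.swap x z y ∈ U := by
    intro y hy
    rw [Equiv.swap_apply_def]
    split_ifs <;> assumption
  refine Finset.card_bij' (fun π _ => π * Equiv.swap x z) (fun π _ => π * Equiv.swap x z)
    ?_ ?_ ?_ ?_
  · intro π h
    simp only [Finset.mem_filter, Finset.mem_univ, true_and, Equiv.Perm.mul_apply,
      Equiv.swap_apply_right] at h ⊢
    exact fun y hy => h _ (hs y hy)
  · intro π h
    simp only [Finset.mem_filter, Finset.mem_univ, true_and, Equiv.Perm.mul_apply,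
      Equiv.swap_apply_left] at h ⊢
    exact fun y hy => h _ (hs y hy)
  · intro π _
    simp [mul_assoc]
  · intro π _
    simp [mul_assoc]

theorem aux_count {n : ℕ} (U C : Finset (Fin n)) (hC : C ⊆ U) {z : Fin n} (hz : z ∈ U) :
    (Finset.univ.filter (fun π : Equiv.Perm (Fin n) => ∃ x ∈ C, ∀ y ∈ U, π x ≤ π y)).card
      = C.card *
        (Finset.univ.filter (fun π : Equiv.Perm (Fin n) => ∀ y ∈ U, π z ≤ π y)).card := by
  have h : Finset.univ.filter (fun π : Equiv.Perm (Fin n) => ∃ x ∈ C, ∀ y ∈ U, π x ≤ π y)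
      = C.biUnion (fun x =>
        Finset.univ.filter (fun π : Equiv.Perm (Fin n) => ∀ y ∈ U, π x ≤ π y)) := by
    ext π
    simp
  rw [h, Finset.card_biUnion, Finset.sum_congr rfl
    (fun x hx => aux_card_eq U (hC hx) hz), Finset.sum_const, smul_eq_mul]
  intro x hx w hw hne
  rw [Function.onFun, Finset.disjoint_left]
  intro π h1 h2
  simp only [Finset.mem_filter, Finset.mem_univ, true_and] at h1 h2
  exact hne (π.injective (le_antisymm (h1 w (hC hw)) (h2 x (hC hx))))

/-- minwise hashing is an LSH for Jaccard similarity.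
Let `n ≥ 1` and let `A, B` be nonempty finite subsets of `Fin n`. For a uniformly
random permutation `π` of `Fin n`, the probability that
`min (π '' A) = min (π '' B)` equals the Jaccard similarity
`J(A,B) = |A ∩ B| / |A ∪ B|`; equivalently (as stated here), the number of
permutations `π` of `Fin n` with `min (π '' A) = min (π '' B)` equals
`(|A ∩ B| / |A ∪ B|) · n!`. -/
theorem stmt_5 (n : ℕ) (hn : 1 ≤ n) (A B : Finset (Fin n))
    (hA : A.Nonempty) (hB : B.Nonempty) :
    ((Finset.univ.filter (fun π : Equiv.Perm (Fin n) =>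
        (A.image π).min' (hA.image π) = (B.image π).min' (hB.image π))).card : ℝ)
      = ((A ∩ B).card : ℝ) / ((A ∪ B).card : ℝ) * (Nat.factorial n : ℝ) := by
  obtain ⟨z, hzA⟩ := hA
  have hz : z ∈ A ∪ B := Finset.mem_union_left _ hzA
  have h1 := aux_count (A ∪ B) (A ∩ B)
    (fun x hx => Finset.mem_union_left _ (Finset.mem_inter.1 hx).1) hz
  have h2 := aux_count (A ∪ B) (A ∪ B) (Finset.Subset.refl _) hz
  have h3 : Finset.univ.filter (fun π : Equiv.Perm (Fin n) =>
      ∃ x ∈ A ∪ B, ∀ y ∈ A ∪ B, π x ≤ π y) = Finset.univ := by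
    rw [Finset.filter_true_of_mem]
    intro π _
    exact Finset.exists_min_image (A ∪ B) π ⟨z, hz⟩
  rw [h3, Finset.card_univ, Fintype.card_perm, Fintype.card_fin] at h2
  have h4 : Finset.univ.filter (fun π : Equiv.Perm (Fin n) =>
        (A.image π).min' (Finset.Nonempty.image ⟨z, hzA⟩ π) = (B.image π).min' (hB.image π))
      = Finset.univ.filter (fun π : Equiv.Perm (Fin n) =>
        ∃ x ∈ A ∩ B, ∀ y ∈ A ∪ B, π x ≤ π y) := by
    apply Finset.filter_congr
    intro π _
    constructor
    · intro h
      obtain ⟨a, ha, hae⟩ := Finset.mem_image.1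
        ((A.image π).min'_mem (Finset.Nonempty.image ⟨z, hzA⟩ π))
      obtain ⟨b, hb, hbe⟩ := Finset.mem_image.1 ((B.image π).min'_mem (hB.image π))
      have hab : a = b := π.injective (by rw [hae, hbe, h])
      refine ⟨a, Finset.mem_inter.2 ⟨ha, hab ▸ hb⟩, fun y hy => ?_⟩
      rcases Finset.mem_union.1 hy with hy | hy
      · rw [hae]
        exact Finset.min'_le _ _ (Finset.mem_image_of_mem _ hy)
      · rw [hae, h]
        exact Finset.min'_le _ _ (Finset.mem_image_of_mem _ hy)
    · rintro ⟨x, hx, hmin⟩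
      obtain ⟨hxA, hxB⟩ := Finset.mem_inter.1 hx
      have key : ∀ (S : Finset (Fin n)) (hS : (S.image π).Nonempty), S ⊆ A ∪ B → x ∈ S →
          (S.image π).min' hS = π x := by
        intro S hS hSU hxS
        apply le_antisymm
        · exact Finset.min'_le _ _ (Finset.mem_image_of_mem _ hxS)
        · apply Finset.le_min'
          intro w hw
          obtain ⟨y, hy, rfl⟩ := Finset.mem_image.1 hw
          exact hmin y (hSU hy)
      rw [key A _ Finset.subset_union_left hxA, key B _ Finset.subset_union_right hxB]
  rw [h4, h1, h2]
  have h5 : ((A ∪ B).card : ℝ) ≠ 0 := by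
    exact_mod_cast (Finset.card_pos.2 ⟨z, hz⟩).ne'
  push_cast
  field_simp
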